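/- Let 𝒜 be an associative ℂ-algebra containing elements t_{i,j} (1 ≤ i,j ≤ n) with t_{i,i} = 0, t_{i,j} = t_{j,i}, satisfying the infinitesimal braid relations: [t_{i,k}+t_{j,k}, t_{i,j}] = 0 for distinct i,j,k and [t_{i,j}, t_{k,l}] = 0 for distinct i,j,k,l. On ℂ*ⁿ = {z ∈ ℂⁿ : z_i ≠ z_j for i ≠ j}, set u_{i,j}(z) = (z_i − z_j)^{-1} and U_i(z) = Σ_{j≠i} t_{i,j}·u_{i,j}(z). Then: (1) Σ_{i=1}^n U_i = 0; (2) Σ_{i=1}^n z_i·U_i(z) = Σ_{1≤i<j≤n} t_{i,j}; (3) ∂_i U_j − ∂_j U_i = [U_i, U_j] = 0 for all i,j. Consequently the connection form Mₙ = Σ_{i=1}^n U_i dz_i = Σ_{1≤i<j≤n} t_{i,j} d log(z_i − z_j) satisfies Mₙ ∧ Mₙ = 0 and dMₙ = 0; hence the universal KZ connection Ωₙ = Mₙ/(2πi) is flat: dΩₙ − Ωₙ ∧ Ωₙ = 0. -/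

import Mathlib

/- STATEMENT 19: with t_{i,j} satisfying the infinitesimal braid relations and
   U_i(z) = Σ_{j≠i} t_{i,j}/(z_i−z_j) on the configuration space ℂ*ⁿ:
   (1) Σ_i U_i = 0; (2) Σ_i z_i U_i(z) = Σ_{i<j} t_{i,j};
   (3) ∂_i U_j − ∂_j U_i = [U_i,U_j] = 0. Consequently Mₙ = Σ_i U_i dz_i satisfies
   Mₙ∧Mₙ = 0 and dMₙ = 0, and Ωₙ = Mₙ/(2πi) is flat: dΩₙ − Ωₙ∧Ωₙ = 0. -/

open scoped BigOperators

namespace KZ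

variable {𝒜 : Type*} [Ring 𝒜] [Algebra ℂ 𝒜] {n : ℕ}

/-- The configuration space `ℂ*ⁿ = {z : z_i ≠ z_j for i ≠ j}`. -/
def Conf (n : ℕ) : Set (Fin n → ℂ) := {z | ∀ i j : Fin n, i ≠ j → z i ≠ z j}

/-- `U_i(z) = Σ_{j≠i} t_{i,j}·(z_i − z_j)⁻¹`. -/
noncomputable def U (t : Fin n → Fin n → 𝒜) (i : Fin n) (z : Fin n → ℂ) : 𝒜 :=
  ∑ j ∈ Finset.univ.erase i, ((z i - z j)⁻¹) • t i j

/-- The partial derivative `∂_i U_j` (computed coefficientwise on the rational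
coefficients `u_{j,l}(z) = (z_j−z_l)⁻¹`). -/
noncomputable def pdU (t : Fin n → Fin n → 𝒜) (i j : Fin n) (z : Fin n → ℂ) : 𝒜 :=
  ∑ l ∈ Finset.univ.erase j,
    (fderiv ℂ (fun y : Fin n → ℂ => (y j - y l)⁻¹) z (Pi.single i 1)) • t j l

end KZ

open KZ

namespace KZ

variable {𝒜 : Type*} [Ring 𝒜] [Algebra ℂ 𝒜] {n : ℕ}

/-- The diagonal term of `U` vanishes, so the sum may run over all indices. -/
theorem U_eq_sum (t : Fin n → Fin n → 𝒜) (i : Fin n) (z : Fin n → ℂ) :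
    U t i z = ∑ j, (z i - z j)⁻¹ • t i j := by
  rw [U, ← Finset.add_sum_erase _ _ (Finset.mem_univ i)]
  simp

theorem U_eq_add_sum (t : Fin n → Fin n → 𝒜) {i j : Fin n} (hij : i ≠ j) (z : Fin n → ℂ) :
    U t i z = (z i - z j)⁻¹ • t i j +
      ∑ k ∈ (Finset.univ.erase i).erase j, (z i - z k)⁻¹ • t i k :=
  (Finset.add_sum_erase _ _ (Finset.mem_erase.2 ⟨hij.symm, Finset.mem_univ j⟩)).symm

theorem sum_U_eq_zero (t : Fin n → Fin n → 𝒜) (hsymm : ∀ i j, t i j = t j i)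
    (z : Fin n → ℂ) : ∑ i, U t i z = 0 := by
  have h : ∑ i, U t i z = -∑ i, U t i z := by
    simp only [U_eq_sum]
    conv_lhs => rw [Finset.sum_comm]
    simp only [← Finset.sum_neg_distrib]
    refine Finset.sum_congr rfl fun i _ => Finset.sum_congr rfl fun j _ => ?_
    rw [hsymm j i, ← neg_smul, ← inv_neg, neg_sub]
  have h2 : (2 : ℂ) • ∑ i, U t i z = 0 := by
    rw [two_smul]
    nth_rewrite 1 [h]
    exact neg_add_cancel _
  exact (smul_eq_zero.1 h2).resolve_left two_ne_zero

/-- A symmetric family with zero diagonal sums to twice its sum over increasing pairs. -/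
theorem sum_sum_eq_two_smul (t : Fin n → Fin n → 𝒜) (hdiag : ∀ i, t i i = 0)
    (hsymm : ∀ i j, t i j = t j i) :
    ∑ i, ∑ j, t i j = (2 : ℂ) •
      ∑ p ∈ Finset.univ.filter (fun p : Fin n × Fin n => p.1 < p.2), t p.1 p.2 := by
  have hlt : ∑ p ∈ Finset.univ.filter (fun p : Fin n × Fin n => p.1 < p.2), t p.1 p.2 =
      ∑ i, ∑ j, if i < j then t i j else 0 := by
    rw [Finset.sum_filter, Fintype.sum_prod_type]
  rw [hlt, two_smul]
  nth_rewrite 2 [Finset.sum_comm]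
  simp only [← Finset.sum_add_distrib]
  refine Finset.sum_congr rfl fun i _ => Finset.sum_congr rfl fun j _ => ?_
  rcases lt_trichotomy i j with h | h | h
  · simp [h, h.not_gt]
  · simp [h, hdiag]
  · simp [h, h.not_gt, hsymm i j]

theorem sum_smul_U (t : Fin n → Fin n → 𝒜) (hdiag : ∀ i, t i i = 0)
    (hsymm : ∀ i j, t i j = t j i) {z : Fin n → ℂ} (hz : z ∈ Conf n) :
    ∑ i, z i • U t i z =
      ∑ p ∈ Finset.univ.filter (fun p : Fin n × Fin n => p.1 < p.2), t p.1 p.2 := by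
  refine smul_right_injective 𝒜 (two_ne_zero (α := ℂ)) ?_
  simp only
  rw [← sum_sum_eq_two_smul t hdiag hsymm, two_smul]
  simp only [U_eq_sum, Finset.smul_sum]
  nth_rewrite 2 [Finset.sum_comm]
  simp only [← Finset.sum_add_distrib]
  refine Finset.sum_congr rfl fun i _ => Finset.sum_congr rfl fun j _ => ?_
  rcases eq_or_ne i j with rfl | h
  · simp [hdiag]
  · have h1 : z i - z j ≠ 0 := sub_ne_zero.2 (hz i j h)
    rw [hsymm j i, smul_smul, smul_smul, ← add_smul]
    have h3 : z i * (z i - z j)⁻¹ + z j * (z j - z i)⁻¹ = 1 := by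
      rw [← neg_sub (z i) (z j), inv_neg]
      field_simp
      ring
    rw [h3, one_smul]

theorem lie_smul_smul (a b : ℂ) (x y : 𝒜) : ⁅a • x, b • y⁆ = (a * b) • ⁅x, y⁆ := by
  rw [Ring.lie_def, Ring.lie_def, smul_mul_smul_comm, smul_mul_smul_comm, mul_comm b a,
    smul_sub]

section Commutator

attribute [local instance] LieRing.ofAssociativeRing LieAlgebra.ofAssociativeAlgebra

theorem lie_U_eq_zero (t : Fin n → Fin n → 𝒜) (hsymm : ∀ i j, t i j = t j i)
    (hbraid₁ : ∀ i j k : Fin n, i ≠ j → j ≠ k → i ≠ k → ⁅t i k + t j k, t i j⁆ = 0)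
    (hbraid₂ : ∀ i j k l : Fin n, i ≠ j → i ≠ k → i ≠ l → j ≠ k → j ≠ l → k ≠ l →
      ⁅t i j, t k l⁆ = 0)
    {z : Fin n → ℂ} (hz : z ∈ Conf n) (i j : Fin n) : ⁅U t i z, U t j z⁆ = 0 := by
  rcases eq_or_ne i j with rfl | hij
  · exact lie_self (U t i z)
  rw [U_eq_add_sum t hij, U_eq_add_sum t hij.symm, hsymm j i,
    Finset.erase_right_comm (a := j) (b := i)]
  have hsum : ∑ k ∈ (Finset.univ.erase i).erase j,
        ∑ l ∈ (Finset.univ.erase i).erase j,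
          ⁅(z i - z k)⁻¹ • t i k, (z j - z l)⁻¹ • t j l⁆ =
      ∑ k ∈ (Finset.univ.erase i).erase j,
        ⁅(z i - z k)⁻¹ • t i k, (z j - z k)⁻¹ • t j k⁆ := by
    refine Finset.sum_congr rfl fun k hk => Finset.sum_eq_single_of_mem k hk fun l hl hlk => ?_
    simp only [Finset.mem_erase, Finset.mem_univ, and_true] at hk hl
    rw [smul_lie, lie_smul, hbraid₂ i k j l hk.2.symm hij hl.2.symm hk.1 hlk.symm hl.1.symm,
      smul_zero, smul_zero]
  rw [add_lie, lie_add, lie_add, smul_lie, lie_smul, lie_self, smul_zero, smul_zero, zero_add,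
    lie_sum, sum_lie, sum_lie]
  simp only [lie_sum]
  rw [hsum, ← Finset.sum_add_distrib, ← Finset.sum_add_distrib]
  refine Finset.sum_eq_zero fun k hk => ?_
  simp only [Finset.mem_erase, Finset.mem_univ, and_true] at hk
  have hik : i ≠ k := hk.2.symm
  have hjk : j ≠ k := hk.1.symm
  have h1 : ⁅t i k, t i j⁆ = ⁅t i j, t j k⁆ := by
    have h := hbraid₁ i j k hij hjk hik
    rw [add_lie] at h
    rw [eq_neg_of_add_eq_zero_left h, lie_skew]
  have h2 : ⁅t i k, t j k⁆ = -⁅t i j, t j k⁆ := by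
    have h := hbraid₁ i k j hik hjk.symm hij
    rw [add_lie, hsymm k j] at h
    rw [← h1, ← lie_skew, ← lie_skew (t i k) (t i j), eq_neg_of_add_eq_zero_left h, neg_neg]
  have hij' : z i - z j ≠ 0 := sub_ne_zero.2 (hz i j hij)
  have hik' : z i - z k ≠ 0 := sub_ne_zero.2 (hz i k hik)
  have hjk' : z j - z k ≠ 0 := sub_ne_zero.2 (hz j k hjk)
  have hcoeff : (z i - z j)⁻¹ * (z j - z k)⁻¹ + (z i - z k)⁻¹ * (z j - z i)⁻¹ -
      (z i - z k)⁻¹ * (z j - z k)⁻¹ = 0 := by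
    rw [← neg_sub (z i) (z j), inv_neg]
    field_simp
    ring
  simp only [smul_lie, lie_smul, h1, h2, smul_neg, smul_smul]
  rw [← neg_smul, ← add_smul, ← add_smul]
  convert zero_smul ℂ _ using 2
  rw [← hcoeff]
  ring

end Commutator

theorem fderiv_inv_sub_apply {z : Fin n → ℂ} {j l : Fin n} (h : z j ≠ z l) (v : Fin n → ℂ) :
    fderiv ℂ (fun y : Fin n → ℂ => (y j - y l)⁻¹) z v =
      -((z j - z l) ^ 2)⁻¹ * (v j - v l) := by
  have hsub : HasFDerivAt (fun y : Fin n → ℂ => y j - y l)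
      (ContinuousLinearMap.proj (R := ℂ) (φ := fun _ : Fin n => ℂ) j -
        ContinuousLinearMap.proj (R := ℂ) (φ := fun _ : Fin n => ℂ) l) z :=
    (hasFDerivAt_apply j z).sub (hasFDerivAt_apply l z)
  have hinv : HasFDerivAt (fun y : Fin n → ℂ => (y j - y l)⁻¹) _ z :=
    (hasDerivAt_inv (sub_ne_zero.2 h)).comp_hasFDerivAt z hsub
  rw [hinv.fderiv]
  simp

theorem pdU_eq_smul (t : Fin n → Fin n → 𝒜) {z : Fin n → ℂ} (hz : z ∈ Conf n) {i j : Fin n}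
    (hij : i ≠ j) : pdU t i j z = ((z j - z i) ^ 2)⁻¹ • t j i := by
  rw [pdU, Finset.sum_eq_single_of_mem i (Finset.mem_erase.2 ⟨hij, Finset.mem_univ i⟩)]
  · rw [fderiv_inv_sub_apply (hz j i hij.symm)]
    simp [hij.symm]
  · intro l hl hli
    rw [fderiv_inv_sub_apply (hz j l (Finset.ne_of_mem_erase hl).symm)]
    simp [hij.symm, hli]

theorem pdU_comm (t : Fin n → Fin n → 𝒜) (hsymm : ∀ i j, t i j = t j i) {z : Fin n → ℂ}
    (hz : z ∈ Conf n) (i j : Fin n) : pdU t i j z = pdU t j i z := by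
  rcases eq_or_ne i j with rfl | hij
  · rfl
  · rw [pdU_eq_smul t hz hij, pdU_eq_smul t hz hij.symm, hsymm j i, ← neg_sub (z i), neg_sq]

end KZ

theorem statement19 {𝒜 : Type*} [Ring 𝒜] [Algebra ℂ 𝒜] {n : ℕ}
    (t : Fin n → Fin n → 𝒜)
    (hdiag : ∀ i, t i i = 0)
    (hsymm : ∀ i j, t i j = t j i)
    -- infinitesimal braid relations
    (hbraid₁ : ∀ i j k : Fin n, i ≠ j → j ≠ k → i ≠ k → ⁅t i k + t j k, t i j⁆ = 0)
    (hbraid₂ : ∀ i j k l : Fin n, i ≠ j → i ≠ k → i ≠ l → j ≠ k → j ≠ l → k ≠ l →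
      ⁅t i j, t k l⁆ = 0) :
    ∀ z ∈ Conf n,
      -- (1) Σ_i U_i = 0
      (∑ i, U t i z = 0) ∧
      -- (2) Σ_i z_i·U_i(z) = Σ_{i<j} t_{i,j}
      (∑ i, z i • U t i z =
        ∑ p ∈ Finset.univ.filter (fun p : Fin n × Fin n => p.1 < p.2), t p.1 p.2) ∧
      -- (3) ∂_i U_j − ∂_j U_i = [U_i, U_j] = 0
      (∀ i j, pdU t i j z - pdU t j i z = ⁅U t i z, U t j z⁆ ∧ ⁅U t i z, U t j z⁆ = 0) ∧
      -- consequently Mₙ ∧ Mₙ = 0 (coefficientwise: [U_i,U_j] = 0) and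
      -- dMₙ = 0 (coefficientwise: ∂_i U_j − ∂_j U_i = 0) …
      (∀ i j, ⁅U t i z, U t j z⁆ = 0 ∧ pdU t i j z = pdU t j i z) ∧
      -- … hence Ωₙ = Mₙ/(2πi) is flat: dΩₙ − Ωₙ ∧ Ωₙ = 0 (coefficientwise)
      (∀ i j,
        (2 * Real.pi * Complex.I)⁻¹ • (pdU t i j z - pdU t j i z) -
          ⁅(2 * Real.pi * Complex.I)⁻¹ • U t i z,
            (2 * Real.pi * Complex.I)⁻¹ • U t j z⁆ = 0) := by
  intro z hz
  have hlie := lie_U_eq_zero t hsymm hbraid₁ hbraid₂ hz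
  have hpd := pdU_comm t hsymm hz
  refine ⟨sum_U_eq_zero t hsymm z, sum_smul_U t hdiag hsymm hz, fun i j => ⟨?_, hlie i j⟩,
    fun i j => ⟨hlie i j, hpd i j⟩, fun i j => ?_⟩
  · rw [hpd i j, hlie i j, sub_self]
  · rw [hpd i j, KZ.lie_smul_smul, hlie i j, sub_self, smul_zero, smul_zero, sub_self]
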